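/- arXiv:1410.2818 — 2 statements merged into one kernel-verified Lean document; each statement's English description precedes it below -/
import Mathlib

section
/- Let P be a symmetric positive definite real 3×3 matrix with (unique symmetric positive definite) square root U (U² = P), and let X be a real 3×3 matrix such that X P is symmetric. Then tr[(dev₃ X)²] = ‖dev₃(U⁻¹ X U)‖² ≥ 0. In particular tr[(dev₃ X)²] is nonnegative under these hypotheses. -/
open Matrix

noncomputable section

/-- 3×3 real matrices. -/
abbrev M3 := Matrix (Fin 3) (Fin 3) ℝ

/-- Squared Frobenius norm: ‖X‖² = tr(X Xᵀ). -/
def frobNormSq (X : M3) : ℝ := (X * Xᵀ).trace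

/-- Deviatoric part: dev₃ X = X − (1/3) tr(X) 𝟙. -/
def dev3 (X : M3) : M3 := X - (X.trace / 3) • (1 : M3)

theorem frobNormSq_nonneg (X : M3) : 0 ≤ frobNormSq X := by
  simp only [frobNormSq, trace, diag_apply, mul_apply, transpose_apply]
  exact Finset.sum_nonneg fun i _ => Finset.sum_nonneg fun j _ => mul_self_nonneg (X i j)

theorem transpose_dev3 (X : M3) : (dev3 X)ᵀ = dev3 Xᵀ := by
  simp [dev3]

theorem dev3_conj {U : M3} (hU : IsUnit U.det) (X : M3) :
    dev3 (U⁻¹ * X * U) = U⁻¹ * dev3 X * U := by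
  have htr : (U⁻¹ * X * U).trace = X.trace := by
    rw [trace_mul_comm, ← Matrix.mul_assoc, mul_nonsing_inv _ hU, Matrix.one_mul]
  simp [dev3, htr, Matrix.mul_sub, Matrix.sub_mul, nonsing_inv_mul _ hU]

theorem transpose_conj_sqrt {U X : M3} (hU : IsUnit U.det) (hUT : Uᵀ = U)
    (hX : (X * (U * U))ᵀ = X * (U * U)) : (U⁻¹ * X * U)ᵀ = U⁻¹ * X * U := by
  have hX' : U * U * Xᵀ = X * (U * U) := by
    simpa [transpose_mul, hUT] using hX
  calc (U⁻¹ * X * U)ᵀ = U * Xᵀ * U⁻¹ := by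
        simp [transpose_mul, transpose_nonsing_inv, hUT, Matrix.mul_assoc]
    _ = U⁻¹ * (U * U * Xᵀ) * U⁻¹ := by
        simp only [← Matrix.mul_assoc, nonsing_inv_mul _ hU, Matrix.one_mul]
    _ = U⁻¹ * X * U := by
        rw [hX']
        simp only [Matrix.mul_assoc, mul_nonsing_inv _ hU, Matrix.mul_one]

/-- Let `P` be symmetric positive definite with square root `U` (`U² = P`, `U` symmetric
positive definite), and let `X` be such that `X P` is symmetric. Then
tr[(dev₃ X)²] = ‖dev₃(U⁻¹ X U)‖² ≥ 0. -/
theorem stmt7 (P U X : M3) (hP : P.PosDef) (hU : U.PosDef) (hUP : U * U = P)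
    (hXP : (X * P)ᵀ = X * P) :
    (dev3 X * dev3 X).trace = frobNormSq (dev3 (U⁻¹ * X * U)) ∧
    0 ≤ (dev3 X * dev3 X).trace := by
  subst hUP
  have hdet : IsUnit U.det := hU.det_pos.ne'.isUnit
  have hUT : Uᵀ = U := by simpa using hU.isHermitian.eq
  have key : (dev3 X * dev3 X).trace = frobNormSq (dev3 (U⁻¹ * X * U)) := by
    rw [frobNormSq, transpose_dev3, transpose_conj_sqrt hdet hUT hXP, dev3_conj hdet]
    calc (dev3 X * dev3 X).trace = (U * (U⁻¹ * (dev3 X * dev3 X))).trace := by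
          rw [mul_nonsing_inv_cancel_left _ _ hdet]
      _ = (U⁻¹ * (dev3 X * dev3 X) * U).trace := trace_mul_comm _ _
      _ = _ := by
          simp only [Matrix.mul_assoc, mul_nonsing_inv_cancel_left _ _ hdet]
  exact ⟨key, key ▸ frobNormSq_nonneg _⟩
end
end

section
/- Let A and B be symmetric positive definite real 3×3 matrices, and let √A denote the (unique symmetric positive definite) square root of A. Then ⟨(A B⁻¹)ᵀ, dev₃(A B⁻¹)⟩ = ‖dev₃(√A · B⁻¹ · √A)‖² ≥ 0. -/
open Matrix

noncomputable section

/-- Frobenius inner product: ⟨X,Y⟩ = tr(X Yᵀ). -/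
def frobInner (X Y : M3) : ℝ := (X * Yᵀ).trace

theorem frobInner_transpose_dev3 (X : M3) :
    frobInner Xᵀ (dev3 X) = (X * X).trace - X.trace ^ 2 / 3 := by
  rw [frobInner, ← transpose_mul, trace_transpose, dev3, sub_mul, trace_sub, smul_mul, one_mul,
    trace_smul, smul_eq_mul]
  ring

theorem frobNormSq_dev3_of_isSymm {S : M3} (hS : S.IsSymm) :
    frobNormSq (dev3 S) = (S * S).trace - S.trace ^ 2 / 3 := by
  have hdev : (dev3 S)ᵀ = dev3 S := by
    rw [dev3, transpose_sub, transpose_smul, transpose_one, hS.eq]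
  rw [frobNormSq, hdev, dev3]
  simp only [sub_mul, mul_sub, smul_mul, Matrix.mul_smul, one_mul, mul_one, trace_sub, trace_smul,
    smul_eq_mul, trace_one, Fintype.card_fin]
  push_cast
  ring

/-- Let `A`, `B` be symmetric positive definite and `sA` the (symmetric positive definite)
square root of `A`. Then ⟨(A B⁻¹)ᵀ, dev₃(A B⁻¹)⟩ = ‖dev₃(√A B⁻¹ √A)‖² ≥ 0. -/
theorem stmt18 (A B sA : M3) (hA : A.PosDef) (hB : B.PosDef) (hsA : sA.PosDef)
    (hsq : sA * sA = A) :
    frobInner ((A * B⁻¹)ᵀ) (dev3 (A * B⁻¹)) = frobNormSq (dev3 (sA * B⁻¹ * sA)) ∧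
    0 ≤ frobInner ((A * B⁻¹)ᵀ) (dev3 (A * B⁻¹)) := by
  have hsymm : (sA * B⁻¹ * sA).IsSymm := by
    have h₁ : sAᵀ = sA := by simpa using hsA.isHermitian.eq
    have h₂ : (B⁻¹)ᵀ = B⁻¹ := by simpa using hB.inv.isHermitian.eq
    rw [IsSymm, transpose_mul, transpose_mul, h₁, h₂, mul_assoc]
  have htr : (sA * B⁻¹ * sA).trace = (A * B⁻¹).trace := by
    rw [trace_mul_comm, ← mul_assoc, hsq]
  have htr_sq : (sA * B⁻¹ * sA * (sA * B⁻¹ * sA)).trace = (A * B⁻¹ * (A * B⁻¹)).trace := by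
    rw [← mul_assoc, trace_mul_comm, ← hsq]
    simp only [mul_assoc]
  have heq : frobInner ((A * B⁻¹)ᵀ) (dev3 (A * B⁻¹)) = frobNormSq (dev3 (sA * B⁻¹ * sA)) := by
    rw [frobInner_transpose_dev3, frobNormSq_dev3_of_isSymm hsymm, htr, htr_sq]
  exact ⟨heq, heq ▸ frobNormSq_nonneg _⟩
end
end
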